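/- Let m be a formal n-parameter family of A∞-structures on V with parameters of even degrees, and let P and Q be any two iterated cup products (with any bracketing) of partial derivatives m_{(i_1)},…,m_{(i_p)} and m_{(j_1)},…,m_{(j_q)} respectively, where the cup product of homogeneous A, B ∈ W[[t_1,…,t_n]] is A∪B = (−1)^{|A|−1} m{A,B}. Then the Gerstenhaber bracket [P, Q] is an M_1-coboundary: [P,Q] = M_1(R) for some homogeneous R ∈ W[[t_1,…,t_n]]. (In other words, the Lie bracket induced on the subalgebra of M_1-cohomology generated by the classes of the m_{(i)}'s under the cup product is trivial.) -/

import Mathlib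

namespace Ainf

variable (k : Type*) [Field k] [CharZero k]
variable (V : ℤ → Type*) [∀ l, AddCommGroup (V l)] [∀ l, Module k (V l)]

/-- Homogeneous elements of `V`, tagged with their degree. -/
abbrev HV := Σ l : ℤ, V l

/-- Total degree of a list of homogeneous elements. -/
def degSum (vs : List (HV V)) : ℤ := (vs.map Sigma.fst).sum

/-- Cast between homogeneous components (junk value `0` if the degrees differ;
in all intended uses the degrees provably agree). -/
def vcast {a b : ℤ} (x : V a) : V b := if h : a = b then h ▸ x else 0

/-- A homogeneous degree-`d` element of `Hom(T(V),V)`, encoded by its values on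
tuples (lists) of homogeneous elements of `V`. -/
abbrev E (d : ℤ) := (vs : List (HV V)) → V (d + degSum V vs)

/-- Multilinearity (over `k`, in each slot) of a graded map: this singles out the
elements of `W = Hom(T(V),V)` among all functions on homogeneous tuples. -/
def IsMultilinear {d : ℤ} (f : E V d) : Prop :=
  (∀ (xs zs : List (HV V)) (l : ℤ) (x y : V l),
      (vcast V (f (xs ++ ⟨l, x + y⟩ :: zs)) : V (d + degSum V xs + l + degSum V zs)) =
        vcast V (f (xs ++ ⟨l, x⟩ :: zs)) + vcast V (f (xs ++ ⟨l, y⟩ :: zs))) ∧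
  (∀ (xs zs : List (HV V)) (l : ℤ) (c : k) (x : V l),
      (vcast V (f (xs ++ ⟨l, c • x⟩ :: zs)) : V (d + degSum V xs + l + degSum V zs)) =
        c • vcast V (f (xs ++ ⟨l, x⟩ :: zs)))

/-- All splittings of a list into two consecutive parts. -/
def splits2 {α : Type*} (vs : List α) : List (List α × List α) :=
  (List.range (vs.length + 1)).map fun i => (vs.take i, vs.drop i)

/-- All splittings of a list into three consecutive parts. -/
def splits3 {α : Type*} (vs : List α) : List (List α × List α × List α) :=
  (splits2 vs).flatMap fun p => (splits2 p.2).map fun q => (p.1, q.1, q.2)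

/-- The Gerstenhaber composition product
`(f∘g)(v₁,…) = Σᵢ (−1)^{|g|(|v₁|+⋯+|vᵢ|)} f(v₁,…,vᵢ,g(v_{i+1},…),…)`. -/
def gcomp {a b : ℤ} (f : E V a) (g : E V b) : E V (a + b) := fun vs =>
  ((splits3 vs).map fun p =>
    ((-1 : k) ^ (b * degSum V p.1)) •
      vcast V (f (p.1 ++ ⟨b + degSum V p.2.1, g p.2.1⟩ :: p.2.2))).sum

/-- Degree recast of a graded map (junk when the degrees differ). -/
def recast {a b : ℤ} (f : E V a) : E V b := fun vs => vcast V (f vs)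

/-- The Gerstenhaber bracket `[f,g] = f∘g − (−1)^{|f||g|} g∘f`. -/
def gbr {a b : ℤ} (f : E V a) (g : E V b) : E V (a + b) :=
  gcomp k V f g - ((-1 : k) ^ (a * b)) • recast V (gcomp k V g f)

/-- A homogeneous element of `W`, packaged with its degree. -/
abbrev GE := Σ d : ℤ, E V d

/-- Total degree of a list of homogeneous elements of `W`. -/
def degl (As : List (GE V)) : ℤ := (As.map Sigma.fst).sum

/-- Auxiliary enumeration of all ordered disjoint insertions of the operations `Bs`
into a tuple `vs`, together with the Koszul sign exponents
`ε = Σᵢ |Bᵢ|(|v₁|+⋯+|v_{kᵢ}|)`. -/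
def ins : List (GE V) → List (HV V) → List (ℤ × List (HV V))
  | [], vs => [(0, vs)]
  | B :: Bs, vs =>
    (splits3 vs).flatMap fun p =>
      (ins Bs p.2.2).map fun q =>
        (B.1 * degSum V p.1 + degl V Bs * (degSum V p.1 + degSum V p.2.1) + q.1,
          p.1 ++ ⟨B.1 + degSum V p.2.1, B.2 p.2.1⟩ :: q.2)

/-- The brace operations `A{A₁,…,Aₚ}`. -/
def braces {a : ℤ} (A : E V a) (As : List (GE V)) : E V (a + degl V As) := fun vs =>
  ((ins V As vs).map fun q => ((-1 : k) ^ q.1) • vcast V (A q.2)).sum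

section PowerSeries

variable (ι : Type*) [Fintype ι] [DecidableEq ι] (td : ι → ℤ)

/-- Multi-indices (exponents of the formal variables). -/
abbrev MI := ι → ℕ

/-- Total internal degree `Σᵢ αᵢ·|tᵢ|` of the monomial `t^α`. -/
def degM (α : MI ι) : ℤ := ∑ i, (α i : ℤ) * td i

/-- A homogeneous degree-`d` element of `W[[t₁,…]]`: the coefficient of `t^α` is a
homogeneous element of `W` of degree `d − deg t^α`. -/
abbrev PS (d : ℤ) := (α : MI ι) → E V (d - degM ι td α)

/-- The multi-indices `β ≤ α` (the possible left factors in a decomposition `α = β + γ`). -/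
def below (α : MI ι) : Finset (MI ι) :=
  Fintype.piFinset fun i => Finset.range (α i + 1)

/-- Coefficientwise degree recast on power series. -/
def precast {a b : ℤ} (F : PS V ι td a) : PS V ι td b := fun α => recast V (F α)

/-- The composition product on `W[[t]]`, extended coefficientwise (Cauchy product). -/
def pcomp {a b : ℤ} (F : PS V ι td a) (G : PS V ι td b) : PS V ι td (a + b) := fun α =>
  ∑ β ∈ below ι α, recast V (gcomp k V (F β) (G (α - β)))

/-- The Gerstenhaber bracket on `W[[t]]`. -/
def pbr {a b : ℤ} (F : PS V ι td a) (G : PS V ι td b) : PS V ι td (a + b) :=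
  pcomp k V ι td F G - ((-1 : k) ^ (a * b)) • precast V ι td (pcomp k V ι td G F)

/-- Formal partial derivative `∂F/∂tᵢ` of a power series. -/
def pderiv {d : ℤ} (F : PS V ι td d) (i : ι) : PS V ι td (d - td i) := fun α =>
  ((α i + 1 : ℕ) : k) • recast V (F (α + Pi.single i 1))

/-- The differential `M₁(A) = m∘A − (−1)^{|A|}A∘m` on `W[[t]]`. -/
def pM1 (m : PS V ι td 1) {a : ℤ} (A : PS V ι td a) : PS V ι td (a + 1) :=
  precast V ι td (pcomp k V ι td m A) -
    ((-1 : k) ^ a) • precast V ι td (pcomp k V ι td A m)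

/-- The binary brace `m{A,B}` on `W[[t]]`, extended coefficientwise. -/
def pbr2 (m : PS V ι td 1) {a b : ℤ} (A : PS V ι td a) (B : PS V ι td b) :
    PS V ι td (a + b + 1) := fun α =>
  ∑ β ∈ below ι α, ∑ γ ∈ below ι (α - β),
    recast V (braces k V (m β)
      [⟨a - degM ι td γ, A γ⟩, ⟨b - degM ι td (α - β - γ), B (α - β - γ)⟩])

/-- The cup product `A ∪ B = (−1)^{|A|−1} m{A,B}` on `W[[t]]`. -/
def pcup (m : PS V ι td 1) {a b : ℤ} (A : PS V ι td a) (B : PS V ι td b) :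
    PS V ι td (a + b + 1) :=
  ((-1 : k) ^ (a - 1)) • pbr2 k V ι td m A B

end PowerSeries

/-- Formal iterated cup products (with arbitrary bracketing) of the partial derivatives
`m₍ᵢ₎` of a family of `A∞`-structures. -/
inductive CupExpr (ι : Type*) : Type _
  | leaf : ι → CupExpr ι
  | node : CupExpr ι → CupExpr ι → CupExpr ι

variable {ι : Type*} [Fintype ι] [DecidableEq ι]

/-- Evaluation of a formal cup expression: leaves evaluate to the partial derivatives
`m₍ᵢ₎ = ∂m/∂tᵢ` and nodes to cup products `A ∪ B = (−1)^{|A|−1} m{A,B}`. -/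
def evalCup (td : ι → ℤ) (m : PS V ι td 1) : CupExpr ι → Σ d : ℤ, PS V ι td d
  | .leaf i => ⟨1 - td i, pderiv k V ι td m i⟩
  | .node P Q =>
    ⟨(evalCup td m P).1 + (evalCup td m Q).1 + 1,
      pcup k V ι td m (evalCup td m P).2 (evalCup td m Q).2⟩

section Words

variable {A : Type*} {Y : Type*} [AddCommGroup Y]

/-- The sum of `φ p q` over all deconcatenations `w = p ++ q`. -/
def dsum (φ : List A → List A → Y) (w : List A) : Y :=
  ∑ i ∈ Finset.range (w.length + 1), φ (w.take i) (w.drop i)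

theorem dsum_nil (φ : List A → List A → Y) : dsum φ [] = φ [] [] := by
  simp [dsum]

theorem dsum_cons (φ : List A → List A → Y) (v : A) (w : List A) :
    dsum φ (v :: w) = φ [] (v :: w) + dsum (fun p q => φ (v :: p) q) w := by
  rw [dsum, List.length_cons, Finset.sum_range_succ', add_comm]
  rfl

theorem dsum_congr {φ ψ : List A → List A → Y} {w : List A}
    (h : ∀ p q, p ++ q = w → φ p q = ψ p q) : dsum φ w = dsum ψ w :=
  Finset.sum_congr rfl fun _ _ => h _ _ (List.take_append_drop _ _)

theorem dsum_add (φ ψ : List A → List A → Y) (w : List A) :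
    dsum (fun p q => φ p q + ψ p q) w = dsum φ w + dsum ψ w :=
  Finset.sum_add_distrib

theorem dsum_neg (φ : List A → List A → Y) (w : List A) :
    dsum (fun p q => -φ p q) w = -dsum φ w :=
  Finset.sum_neg_distrib _

theorem dsum_sub (φ ψ : List A → List A → Y) (w : List A) :
    dsum (fun p q => φ p q - ψ p q) w = dsum φ w - dsum ψ w :=
  Finset.sum_sub_distrib _ _

theorem smul_dsum {R : Type*} [Ring R] [Module R Y] (c : R) (φ : List A → List A → Y)
    (w : List A) : c • dsum φ w = dsum (fun p q => c • φ p q) w :=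
  Finset.smul_sum

theorem dsum_comm (F : List A → List A → List A → List A → Y) (w u : List A) :
    dsum (fun p q => dsum (fun x y => F p q x y) u) w =
      dsum (fun x y => dsum (fun p q => F p q x y) w) u :=
  Finset.sum_comm

theorem map_dsum {Z G : Type*} [AddCommGroup Z] [FunLike G Y Z] [AddMonoidHomClass G Y Z] (L : G)
    (φ : List A → List A → Y) (w : List A) :
    L (dsum φ w) = dsum (fun p q => L (φ p q)) w :=
  map_sum L _ _

theorem dsum_assoc (F : List A → List A → List A → List A → Y) (w : List A) :
    dsum (fun x y => dsum (fun p q => F x p q y) x) w =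
      dsum (fun p u => dsum (fun q y => F (p ++ q) p q y) u) w := by
  have key : ∀ (G : List A → List A → List A → Y) (w : List A),
      dsum (fun x y => dsum (fun p q => G p q y) x) w =
        dsum (fun p u => dsum (fun q y => G p q y) u) w := by
    intro G w
    induction w generalizing G with
    | nil => simp [dsum_nil]
    | cons v w ih => simp only [dsum_cons, dsum_nil, dsum_add, ih, add_assoc]
  rw [← key fun p q y => F (p ++ q) p q y]
  refine dsum_congr fun x y _ => dsum_congr fun p q h => ?_
  rw [h]

theorem dsum_assoc' (F : List A → List A → List A → List A → List A → List A → Y) (w : List A) :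
    dsum (fun x y => dsum (fun b c => dsum (fun p q => F x p q y b c) x) y) w =
      dsum (fun p u => dsum (fun q y => dsum (fun b c => F (p ++ q) p q y b c) y) u) w := by
  rw [← dsum_assoc fun x p q y => dsum (fun b c => F x p q y b c) y]
  exact dsum_congr fun x y _ => dsum_comm _ _ _

theorem dsum_append_cons (φ : List A → List A → Y) (p : List A) (v : A) (r : List A) :
    dsum φ (p ++ v :: r) =
      dsum (fun a b => φ a (b ++ v :: r)) p + dsum (fun a b => φ (p ++ v :: a) b) r := by
  induction p generalizing φ with
  | nil => simp [dsum_cons, dsum_nil]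
  | cons x p ih => simp only [List.cons_append, dsum_cons, ih, add_assoc]

theorem sum_map_splits2 (φ : List A → List A → Y) (w : List A) :
    ((splits2 w).map fun p => φ p.1 p.2).sum = dsum φ w := by
  rw [splits2, dsum, Finset.sum_range, List.map_map, ← List.sum_ofFn]
  congr 1
  rw [List.ofFn_eq_map, ← List.map_coe_finRange_eq_range, List.map_map]
  rfl

theorem sum_map_splits3 (φ : List A → List A → List A → Y) (w : List A) :
    ((splits3 w).map fun p => φ p.1 p.2.1 p.2.2).sum =
      dsum (fun p u => dsum (fun q r => φ p q r) u) w := by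
  rw [splits3, List.map_flatMap, List.flatMap_def, List.sum_flatten, List.map_map,
    ← sum_map_splits2]
  simp only [Function.comp_def, List.map_map, ← sum_map_splits2]

end Words

section Insertions

variable {K : Type*} [CommRing K] {A : Type*} {Y : Type*} [AddCommGroup Y] [Module K Y]

/-- The sum of `χ p • φ (p, h q, r)` over all ways `w = p ++ q ++ r` of inserting `h`. -/
def ins1 (χ : List A → K) (h : List A → A) (φ : List A → Y) (w : List A) : Y :=
  dsum (fun p u => dsum (fun q r => χ p • φ (p ++ h q :: r)) u) w

/-- The signed sum over all ordered disjoint insertions of `g` and `h` into a word. -/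
def ins2 (χ ψ : List A → K) (g h : List A → A) (φ : List A → Y) (w : List A) : Y :=
  dsum (fun p u => dsum (fun q r =>
    (χ p * ψ p * ψ q) • ins1 ψ h (fun x => φ (p ++ g q :: x)) r) u) w

variable {χ ψ : List A → K} {g h h₁ h₂ : List A → A}

theorem ins1_dsum (F : List A → List A → List A → Y) (u w : List A) :
    ins1 χ h (fun x => dsum (fun p q => F x p q) u) w =
      dsum (fun p q => ins1 χ h (fun x => F x p q) w) u := by
  simp only [ins1, smul_dsum]
  rw [dsum_comm]
  refine dsum_congr fun p q _ => ?_
  rw [dsum_comm]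

theorem ins1_smul (c : K) (φ : List A → Y) (w : List A) :
    ins1 χ h (fun x => c • φ x) w = c • ins1 χ h φ w := by
  simp only [ins1, smul_dsum, smul_comm c]

theorem ins1_add (φ φ' : List A → Y) (w : List A) :
    ins1 χ h (fun x => φ x + φ' x) w = ins1 χ h φ w + ins1 χ h φ' w := by
  simp only [ins1, smul_add, dsum_add]

theorem ins1_neg (φ : List A → Y) (w : List A) :
    ins1 χ h (fun x => -φ x) w = -ins1 χ h φ w := by
  simp only [ins1, smul_neg, dsum_neg]

theorem ins1_comm (h g : List A → A) (F : List A → List A → Y) (w u : List A) :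
    ins1 χ h (fun x => ins1 ψ g (fun y => F x y) u) w =
      ins1 ψ g (fun y => ins1 χ h (fun x => F x y) w) u := by
  conv_lhs => simp only [ins1.eq_def ψ]
  simp only [ins1_dsum, ins1_smul]
  rfl

theorem ins2_dsum (F : List A → List A → List A → Y) (u w : List A) :
    ins2 χ ψ g h (fun x => dsum (fun p q => F x p q) u) w =
      dsum (fun p q => ins2 χ ψ g h (fun x => F x p q) w) u := by
  simp only [ins2, smul_dsum, ins1_dsum]
  rw [dsum_comm]
  refine dsum_congr fun p q _ => ?_
  rw [dsum_comm]

theorem ins2_smul (c : K) (φ : List A → Y) (w : List A) :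
    ins2 χ ψ g h (fun x => c • φ x) w = c • ins2 χ ψ g h φ w := by
  simp only [ins2, smul_dsum, ins1_smul, smul_comm c]

/-- Inserting `h` is a coderivation for the deconcatenation coproduct. -/
theorem ins1_coderivation (hχ : ∀ x y, χ (x ++ y) = χ x * χ y) (φ : List A → List A → Y)
    (w : List A) :
    ins1 χ h (dsum φ) w =
      dsum (fun x y => ins1 χ h (fun x' => φ x' y) x + χ x • ins1 χ h (φ x) y) w := by
  simp only [ins1, dsum_append_cons, smul_add, dsum_add, smul_dsum, dsum_assoc, dsum_assoc',
    smul_smul, hχ]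
  exact add_comm _ _

/-- The double insertion operator is compatible with the deconcatenation coproduct. -/
theorem ins2_coderivation (hχ : ∀ x y, χ (x ++ y) = χ x * χ y)
    (hψ : ∀ x y, ψ (x ++ y) = ψ x * ψ y) (φ : List A → List A → Y) (w : List A) :
    ins2 χ ψ g h (dsum φ) w =
      dsum (fun x y => ins2 χ ψ g h (fun x' => φ x' y) x +
        ψ x • ins1 χ g (fun x' => ins1 ψ h (φ x') y) x +
        (χ x * ψ x) • ins2 χ ψ g h (φ x) y) w := by
  simp only [ins2, dsum_append_cons, ins1_add, ins1_dsum, ins1_coderivation hψ,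
    ins1.eq_def χ g]
  simp only [smul_add, dsum_add, smul_dsum, dsum_assoc, dsum_assoc', smul_smul, hχ, hψ]
  rw [add_comm]
  refine congrArg₂ _ (congrArg₂ _ rfl ?_) ?_ <;>
  refine dsum_congr fun _ _ _ => dsum_congr fun _ _ _ => dsum_congr fun _ _ _ =>
    congrArg₂ _ ?_ rfl <;>
  ring

/-- A multiplicative `±1`-valued function on words. -/
structure IsSign (s : List A → K) : Prop where
  append : ∀ x y, s (x ++ y) = s x * s y
  sq : ∀ x, s x * s x = 1

/-- The letters produced by `h` have parity opposite to that of the consumed word. -/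
def IsOddFor (s : List A → K) (h : List A → A) : Prop :=
  ∀ q r, s (h q :: r) = -(s q * s r)

variable {s : List A → K}

theorem ins1_odd_smul (hs : IsSign s) (hh : IsOddFor s h) (φ : List A → Y) (w : List A) :
    ins1 χ h (fun x => s x • φ x) w = -(s w • ins1 χ h φ w) := by
  simp only [ins1, smul_dsum, ← dsum_neg]
  refine dsum_congr fun p u h₁ => dsum_congr fun q r h₂ => ?_
  rw [← h₁, ← h₂, hs.append, hs.append, hs.append, hh, smul_smul, smul_smul, ← neg_smul]
  congr 1
  ring

theorem ins2_odd_smul (hs : IsSign s) (hg : IsOddFor s g) (hh : IsOddFor s h) (φ : List A → Y)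
    (w : List A) :
    ins2 χ ψ g h (fun x => s x • φ x) w = s w • ins2 χ ψ g h φ w := by
  simp only [ins2, smul_dsum]
  refine dsum_congr fun p u h₁ => dsum_congr fun q r h₂ => ?_
  simp only [hs.append, hg _ _, mul_smul, neg_smul, smul_neg, ins1_neg, ins1_smul,
    ins1_odd_smul hs hh, ← h₁, ← h₂]
  simp only [smul_smul, neg_neg]
  congr 1
  ring

/-- The pre-Lie relation for odd insertions. -/
theorem ins1_ins1 (hs : IsSign s) (hh : IsOddFor s h) (φ : List A → Y) (w : List A) :
    ins1 s h (ins1 s g φ) w =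
      dsum (fun p u => dsum (fun q r => ins1 s h (fun x => φ (p ++ g x :: r)) q) u) w +
        ins2 s s g h φ w - ins2 s s h g φ w := by
  have e : ins1 s g φ = dsum fun p u => dsum (fun q r => s p • φ (p ++ g q :: r)) u := rfl
  rw [e, ins1_coderivation hs.append]
  simp only [ins1_dsum, ins1_odd_smul hs hh, ins1_coderivation hs.append, ins1_smul]
  simp only [dsum_add, smul_add, smul_dsum, smul_smul, hs.sq, dsum_neg, one_smul]
  have e₁ : dsum (fun p u => dsum (fun q r => s p • ins1 s h (fun x => φ (x ++ g q :: r)) p) u) w =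
      ins2 s s h g φ w := by
    simp only [ins1, ins2, smul_dsum, dsum_assoc', smul_smul, List.append_assoc,
      List.cons_append]
    refine dsum_congr fun p _ _ => dsum_congr fun q _ _ => dsum_congr fun r _ _ =>
      dsum_congr fun _ _ _ => congrArg₂ _ ?_ rfl
    rw [hs.append, hs.append]
    ring
  have e₂ : dsum (fun p u => dsum (fun q r =>
      (s p * (s q * s p)) • ins1 s h (fun x => φ (p ++ g q :: x)) r) u) w =
      ins2 s s g h φ w := by
    rw [ins2]
    refine dsum_congr fun p _ _ => dsum_congr fun q _ _ => congrArg₂ _ ?_ rfl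
    ring
  rw [e₁, e₂]
  abel

/-- The interaction of a double insertion with a single one; all terms with three disjoint
insertions cancel. -/
theorem ins2_ins1_sub_ins1_ins2 (hs : IsSign s) (hg : IsOddFor s g) (h₁o : IsOddFor s h₁)
    (h₂o : IsOddFor s h₂) (φ : List A → Y) (w : List A) :
    ins2 s s h₁ h₂ (ins1 s g φ) w - ins1 s g (ins2 s s h₁ h₂ φ) w =
      dsum (fun p u => dsum (fun q r =>
        s p • ins2 s s h₁ h₂ (fun x => φ (p ++ g x :: r)) q) u) w +
      dsum (fun p u => dsum (fun q r =>
        (s p * s q) • ins1 s h₂ (fun y => ins1 s h₁ (fun x => φ (p ++ g x :: y)) q) r) u) w +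
      dsum (fun p u => dsum (fun q r =>
        (s p * s q) • ins1 s h₂ (fun y => ins1 s g (fun x => φ (p ++ h₁ x :: y)) q) r) u) w -
      dsum (fun p u => dsum (fun q v => s p • dsum (fun a u => dsum (fun b c =>
        ins1 s h₂ (fun x => φ (p ++ h₁ q :: (a ++ g x :: c))) b) u) v) u) w -
      dsum (fun p u => dsum (fun q v => s p • dsum (fun a u => dsum (fun b c =>
        ins1 s g (fun x => φ (p ++ h₁ q :: (a ++ h₂ x :: c))) b) u) v) u) w := by
  have e : ins1 s g φ = dsum fun p u => dsum (fun q r => s p • φ (p ++ g q :: r)) u := rfl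
  have e' : ins2 s s h₁ h₂ φ = dsum fun p u => dsum (fun q r =>
    (s p * s p * s q) • ins1 s h₂ (fun x => φ (p ++ h₁ q :: x)) r) u := rfl
  have hpqp : ∀ p q, s p * (s p * s q) = s q := fun p q => by linear_combination s q * hs.sq p
  have L : ins2 s s h₁ h₂ (ins1 s g φ) w =
      dsum (fun p u => dsum (fun q r =>
        s p • ins2 s s h₁ h₂ (fun x => φ (x ++ g q :: r)) p) u) w -
      dsum (fun p u => dsum (fun q r =>
        ins1 s h₁ (fun x => ins1 s h₂ (fun y => φ (x ++ g y :: r)) q) p) u) w -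
      dsum (fun p u => dsum (fun q r =>
        s q • ins1 s h₁ (fun x => ins1 s h₂ (fun y => φ (x ++ g q :: y)) r) p) u) w +
      dsum (fun p u => dsum (fun q r =>
        s p • ins2 s s h₁ h₂ (fun x => φ (p ++ g x :: r)) q) u) w +
      dsum (fun p u => dsum (fun q r =>
        (s p * s q) • ins1 s h₁ (fun x => ins1 s h₂ (fun y => φ (p ++ g x :: y)) r) q) u) w +
      dsum (fun p u => dsum (fun q r =>
        s p • ins2 s s h₁ h₂ (fun x => φ (p ++ g q :: x)) r) u) w := by
    rw [e, ins2_coderivation hs.append hs.append]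
    simp only [ins2_dsum, ins2_odd_smul hs h₁o h₂o, ins1_coderivation hs.append,
      ins2_coderivation hs.append hs.append, ins1_smul, ins2_smul, hs.sq, one_smul, ins1_dsum,
      ins1_add, ins1_odd_smul hs h₁o]
    simp only [dsum_add, smul_add, smul_dsum, smul_smul, smul_neg, dsum_neg, hs.sq, one_smul,
      mul_comm, hpqp]
    abel
  have R : ins1 s g (ins2 s s h₁ h₂ φ) w =
      dsum (fun p u => dsum (fun q r =>
        s q • ins1 s g (fun x => ins1 s h₂ (fun y => φ (x ++ h₁ q :: y)) r) p) u) w -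
      dsum (fun p u => dsum (fun q r =>
        (s p * s q) • ins1 s g (fun x => ins1 s h₂ (fun y => φ (p ++ h₁ x :: y)) r) q) u) w +
      dsum (fun p u => dsum (fun q v => s p • dsum (fun a u => dsum (fun b c =>
        ins1 s g (fun x => φ (p ++ h₁ q :: (a ++ h₂ x :: c))) b) u) v) u) w +
      dsum (fun p u => dsum (fun q r =>
        s p • ins2 s s h₂ g (fun x => φ (p ++ h₁ q :: x)) r) u) w -
      dsum (fun p u => dsum (fun q r =>
        s p • ins2 s s g h₂ (fun x => φ (p ++ h₁ q :: x)) r) u) w := by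
    rw [e', ins1_coderivation hs.append]
    simp only [hs.sq, one_mul, ins1_dsum, ins1_coderivation hs.append, ins1_smul,
      ins1_odd_smul hs hg, ins1_ins1 hs hg]
    simp only [dsum_add, smul_add, smul_dsum, smul_smul, smul_neg, dsum_neg, hs.sq, one_smul,
      smul_sub, dsum_sub]
    abel
  have T₁ : dsum (fun p u => dsum (fun q r =>
        s p • ins2 s s h₁ h₂ (fun x => φ (x ++ g q :: r)) p) u) w =
      dsum (fun p u => dsum (fun q r =>
        s p • ins2 s s h₂ g (fun x => φ (p ++ h₁ q :: x)) r) u) w := by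
    simp only [ins1, ins2, smul_dsum, dsum_assoc', smul_smul, List.append_assoc,
      List.cons_append]
    refine dsum_congr fun p _ _ => dsum_congr fun q _ _ => dsum_congr fun r _ _ =>
      dsum_congr fun x _ _ => dsum_congr fun y _ _ => dsum_congr fun z _ _ => congrArg₂ _ ?_ rfl
    simp only [hs.append]
    grind [hs.sq]
  have T₂ : dsum (fun p u => dsum (fun q r =>
        s q • ins1 s h₁ (fun x => ins1 s h₂ (fun y => φ (x ++ g q :: y)) r) p) u) w =
      dsum (fun p u => dsum (fun q r =>
        s p • ins2 s s g h₂ (fun x => φ (p ++ h₁ q :: x)) r) u) w := by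
    simp only [ins1, ins2, smul_dsum, dsum_assoc', smul_smul, List.append_assoc,
      List.cons_append]
    refine dsum_congr fun p _ _ => dsum_congr fun q _ _ => dsum_congr fun r _ _ =>
      dsum_congr fun x _ _ => dsum_congr fun y _ _ => dsum_congr fun z _ _ => congrArg₂ _ ?_ rfl
    grind [hs.sq]
  have T₃ : dsum (fun p u => dsum (fun q r =>
        s q • ins1 s g (fun x => ins1 s h₂ (fun y => φ (x ++ h₁ q :: y)) r) p) u) w =
      dsum (fun p u => dsum (fun q r =>
        s p • ins2 s s h₁ h₂ (fun x => φ (p ++ g q :: x)) r) u) w := by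
    simp only [ins1, ins2, smul_dsum, dsum_assoc', smul_smul, List.append_assoc,
      List.cons_append]
    refine dsum_congr fun p _ _ => dsum_congr fun q _ _ => dsum_congr fun r _ _ =>
      dsum_congr fun x _ _ => dsum_congr fun y _ _ => dsum_congr fun z _ _ => congrArg₂ _ ?_ rfl
    grind [hs.sq]
  have T₄ : dsum (fun p u => dsum (fun q r =>
        ins1 s h₁ (fun x => ins1 s h₂ (fun y => φ (x ++ g y :: r)) q) p) u) w =
      dsum (fun p u => dsum (fun q v => s p • dsum (fun a u => dsum (fun b c =>
        ins1 s h₂ (fun x => φ (p ++ h₁ q :: (a ++ g x :: c))) b) u) v) u) w := by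
    simp only [ins1, smul_dsum, dsum_assoc', smul_smul, List.append_assoc,
      List.cons_append]
  rw [L, R, T₁, T₂, T₃, T₄]
  simp only [ins1_comm h₁ h₂, ins1_comm g h₂]
  abel

end Insertions

section Signs

variable {K : Type*} [Field K] {U : ℤ → Type*}

/-- The sign `(-1) ^ (b * |w|)`. -/
def sg (K : Type*) [Field K] (b : ℤ) (w : List (HV U)) : K := (-1) ^ (b * degSum U w)

theorem degSum_append (x y : List (HV U)) : degSum U (x ++ y) = degSum U x + degSum U y := by
  simp [degSum]

theorem degSum_cons (x : HV U) (y : List (HV U)) : degSum U (x :: y) = x.1 + degSum U y := by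
  simp [degSum]

theorem sg_append (b : ℤ) (x y : List (HV U)) : sg K b (x ++ y) = sg K b x * sg K b y := by
  rw [sg, degSum_append, mul_add, zpow_add₀ (by simp)]
  rfl

theorem sg_zero (x : List (HV U)) : sg K 0 x = 1 := by simp [sg]

theorem isSign_sg (b : ℤ) : IsSign (sg K b : List (HV U) → K) where
  append := sg_append b
  sq x := by rw [sg, ← mul_zpow]; simp

end Signs

section Multilinear

variable {K : Type*} [Field K] {U : ℤ → Type*} [∀ l, AddCommGroup (U l)] [∀ l, Module K (U l)]

/-- The total space of a graded vector space. -/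
abbrev Tot (U : ℤ → Type*) [∀ l, AddCommGroup (U l)] := DirectSum ℤ U

variable (K) in
/-- A homogeneous element regarded as an element of the total space. -/
def HV.toTot (x : HV U) : Tot U := DirectSum.lof K ℤ U x.1 x.2

variable (K U) in
/-- Multilinear functions on words of homogeneous elements, with values in the total space. -/
def Mult : Submodule K (List (HV U) → Tot U) where
  carrier := {φ | ∀ xs zs l, IsLinearMap K fun x : U l => φ (xs ++ ⟨l, x⟩ :: zs)}
  zero_mem' _ _ _ := ⟨fun _ _ => by simp, fun _ _ => by simp⟩
  add_mem' hf hg xs zs l :=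
    ⟨fun x y => by simp only [Pi.add_apply, (hf xs zs l).map_add, (hg xs zs l).map_add]; abel,
      fun c x => by
        simp only [Pi.add_apply, (hf xs zs l).map_smul, (hg xs zs l).map_smul, smul_add]⟩
  smul_mem' c f hf xs zs l :=
    ⟨fun x y => by simp only [Pi.smul_apply, (hf xs zs l).map_add, smul_add],
      fun d x => by simp only [Pi.smul_apply, (hf xs zs l).map_smul, smul_comm c d]⟩

theorem dsum_mem {F : List (HV U) → List (HV U) → Tot U} (h₁ : ∀ y, (fun x => F x y) ∈ Mult K U)
    (h₂ : ∀ x, F x ∈ Mult K U) : dsum F ∈ Mult K U := by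
  intro xs zs l
  simp only [dsum_append_cons]
  refine ⟨fun x y => ?_, fun c x => ?_⟩
  · simp only [(h₁ _ _ _ _).map_add, (h₂ _ _ _ _).map_add, dsum_add]
    abel
  · simp only [(h₁ _ _ _ _).map_smul, (h₂ _ _ _ _).map_smul, smul_add, smul_dsum]

theorem dsum_dsum_mem {F : List (HV U) → List (HV U) → List (HV U) → Tot U}
    (h₁ : ∀ y z, (fun x => F x y z) ∈ Mult K U) (h₂ : ∀ x z, (fun y => F x y z) ∈ Mult K U)
    (h₃ : ∀ x y, F x y ∈ Mult K U) :
    (fun w => dsum (fun p u => dsum (fun q r => F p q r) u) w) ∈ Mult K U := by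
  refine dsum_mem (fun u => ?_) fun p => dsum_mem (h₂ p) (h₃ p)
  have : (fun x => dsum (fun q r => F x q r) u) =
      ∑ i ∈ Finset.range (u.length + 1), fun x => F x (u.take i) (u.drop i) := by
    ext1 x
    rw [Finset.sum_apply]
    rfl
  rw [this]
  exact sum_mem fun i _ => h₁ _ _

theorem sg_smul_mem {φ : List (HV U) → Tot U} (b : ℤ) (hφ : φ ∈ Mult K U) :
    (fun w => sg K b w • φ w) ∈ Mult K U := by
  intro xs zs l
  have : ∀ x y : U l, sg K b (xs ++ ⟨l, x⟩ :: zs) = sg K b (xs ++ ⟨l, y⟩ :: zs) := fun x y => by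
    simp only [sg, degSum_append, degSum_cons]
  simp only [fun x => this x 0]
  refine ⟨fun x y => ?_, fun c x => ?_⟩
  · simp only [(hφ _ _ _).map_add, smul_add]
  · simp only [(hφ _ _ _).map_smul, smul_comm c]

theorem map_mem {φ : List (HV U) → Tot U} (L : Tot U →ₗ[K] Tot U) (hφ : φ ∈ Mult K U) :
    (fun w => L (φ w)) ∈ Mult K U := fun xs zs l =>
  ⟨fun x y => by simp only [(hφ xs zs l).map_add, map_add],
    fun c x => by simp only [(hφ xs zs l).map_smul, map_smul]⟩

/-- Extension of a multilinear function to the total space in one slot. -/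
def slot (φ : Mult K U) (p r : List (HV U)) : Tot U →ₗ[K] Tot U :=
  DirectSum.toModule K ℤ _ fun l => (φ.2 p r l).mk' _

theorem slot_toTot (φ : Mult K U) (p r : List (HV U)) (x : HV U) :
    slot φ p r (x.toTot K) = φ.1 (p ++ x :: r) :=
  DirectSum.toModule_lof _ _ _

theorem slot_lof (φ : Mult K U) (p r : List (HV U)) (l : ℤ) (x : U l) :
    slot φ p r (DirectSum.lof K ℤ U l x) = φ.1 (p ++ ⟨l, x⟩ :: r) :=
  slot_toTot φ p r ⟨l, x⟩

theorem slot_add (φ φ' : Mult K U) (p r : List (HV U)) :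
    slot (φ + φ') p r = slot φ p r + slot φ' p r := by
  refine DirectSum.linearMap_ext K fun l => LinearMap.ext fun x => ?_
  simp [slot_lof]

theorem slot_smul (c : K) (φ : Mult K U) (p r : List (HV U)) :
    slot (c • φ) p r = c • slot φ p r := by
  refine DirectSum.linearMap_ext K fun l => LinearMap.ext fun x => ?_
  simp [slot_lof]

theorem slot_right_mem (φ : Mult K U) (p : List (HV U)) (x : Tot U) :
    (fun r => slot φ p r x) ∈ Mult K U := by
  intro xs zs l
  refine ⟨fun y z => ?_, fun c y => ?_⟩
  · have h : slot φ p (xs ++ ⟨l, y + z⟩ :: zs) =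
        slot φ p (xs ++ ⟨l, y⟩ :: zs) + slot φ p (xs ++ ⟨l, z⟩ :: zs) := by
      refine DirectSum.linearMap_ext K fun l => LinearMap.ext fun t => ?_
      simp only [LinearMap.comp_apply, LinearMap.add_apply, slot_lof]
      simpa using (φ.2 (p ++ ⟨_, t⟩ :: xs) zs _).map_add y z
    exact LinearMap.congr_fun h x
  · have h : slot φ p (xs ++ ⟨l, c • y⟩ :: zs) = c • slot φ p (xs ++ ⟨l, y⟩ :: zs) := by
      refine DirectSum.linearMap_ext K fun l => LinearMap.ext fun t => ?_
      simp only [LinearMap.comp_apply, LinearMap.smul_apply, slot_lof]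
      simpa using (φ.2 (p ++ ⟨_, t⟩ :: xs) zs _).map_smul c y
    exact LinearMap.congr_fun h x

/-- Filling the slot after the word `p` of a multilinear function. -/
def plug (p : List (HV U)) (φ : Mult K U) : Tot U →ₗ[K] Mult K U where
  toFun x := ⟨fun r => slot φ p r x, slot_right_mem φ p x⟩
  map_add' x y := Subtype.ext <| funext fun r => by simp
  map_smul' c x := Subtype.ext <| funext fun r => by simp

theorem coe_plug (p : List (HV U)) (φ : Mult K U) (x : Tot U) :
    (plug p φ x).1 = fun r => slot φ p r x := rfl

theorem plug_add (p : List (HV U)) (φ φ' : Mult K U) : plug p (φ + φ') = plug p φ + plug p φ' :=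
  LinearMap.ext fun x => Subtype.ext <| funext fun r => by simp [plug, slot_add]

theorem plug_smul (p : List (HV U)) (c : K) (φ : Mult K U) : plug p (c • φ) = c • plug p φ :=
  LinearMap.ext fun x => Subtype.ext <| funext fun r => by simp [plug, slot_smul]

theorem plug_left_mem (φ : Mult K U) (x : Tot U) (L : Mult K U →ₗ[K] Tot U) :
    (fun p => L (plug p φ x)) ∈ Mult K U := by
  intro xs zs l
  refine ⟨fun y z => ?_, fun c y => ?_⟩
  · have h : plug (xs ++ ⟨l, y + z⟩ :: zs) φ =
        plug (xs ++ ⟨l, y⟩ :: zs) φ + plug (xs ++ ⟨l, z⟩ :: zs) φ := by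
      refine DirectSum.linearMap_ext K fun l => LinearMap.ext fun t =>
        Subtype.ext <| funext fun r => ?_
      simpa [slot_lof, coe_plug] using (φ.2 xs (zs ++ ⟨_, t⟩ :: r) _).map_add y z
    simp only [h, LinearMap.add_apply, map_add]
  · have h : plug (xs ++ ⟨l, c • y⟩ :: zs) φ = c • plug (xs ++ ⟨l, y⟩ :: zs) φ := by
      refine DirectSum.linearMap_ext K fun l => LinearMap.ext fun t =>
        Subtype.ext <| funext fun r => ?_
      simpa [slot_lof, coe_plug] using (φ.2 xs (zs ++ ⟨_, t⟩ :: r) _).map_smul c y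
    simp only [h, LinearMap.smul_apply, map_smul]

/-- Evaluation of a multilinear function on a word. -/
def evalWord (w : List (HV U)) : Mult K U →ₗ[K] Tot U :=
  LinearMap.proj w ∘ₗ (Mult K U).subtype

/-- The composition product of multilinear functions, with Koszul signs for a right factor of
degree `b`. -/
def comp (b : ℤ) : Mult K U →ₗ[K] Mult K U →ₗ[K] Mult K U :=
  LinearMap.mk₂ K
    (fun φ G => ⟨fun w => dsum (fun p u => dsum (fun q r => sg K b p • slot φ p r (G.1 q)) u) w,
      dsum_dsum_mem (fun q r => sg_smul_mem b (plug_left_mem φ (G.1 q) (evalWord r)))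
        (fun p r => Submodule.smul_mem _ _ (map_mem _ G.2))
        (fun p q => Submodule.smul_mem _ _ (slot_right_mem φ p (G.1 q)))⟩)
    (fun φ φ' G => Subtype.ext <| funext fun w => by
      simp [slot_add, smul_add, dsum_add])
    (fun c φ G => Subtype.ext <| funext fun w => by
      simp [slot_smul, smul_dsum, smul_comm c])
    (fun φ G G' => Subtype.ext <| funext fun w => by
      simp [smul_add, dsum_add])
    (fun c φ G => Subtype.ext <| funext fun w => by
      simp [smul_dsum, smul_comm c])

/-- The binary brace `φ{G, H}` of multilinear functions, with Koszul signs for arguments of degrees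
`b` and `c`. -/
def brace (b c : ℤ) : Mult K U →ₗ[K] Mult K U →ₗ[K] Mult K U →ₗ[K] Mult K U :=
  LinearMap.mk₂ K
    (fun φ G =>
      { toFun H := ⟨fun w => dsum (fun p u => dsum (fun q r =>
          (sg K b p * sg K c p * sg K c q) • evalWord r (comp c (plug p φ (G.1 q)) H)) u) w, by
            refine dsum_dsum_mem (fun q r => ?_) (fun p r => ?_) fun p q => ?_
            · simp only [mul_smul]
              exact sg_smul_mem b (sg_smul_mem c (Submodule.smul_mem _ _
                (plug_left_mem φ (G.1 q) (evalWord r ∘ₗ (comp c).flip H))))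
            · simp only [mul_smul]
              exact Submodule.smul_mem _ _ (Submodule.smul_mem _ _ (sg_smul_mem c
                (map_mem (evalWord r ∘ₗ (comp c).flip H ∘ₗ plug p φ) G.2)))
            · exact Submodule.smul_mem _ _ (comp c (plug p φ (G.1 q)) H).2⟩
        map_add' H H' := Subtype.ext <| funext fun w => by
          simp [smul_add, dsum_add]
        map_smul' d H := Subtype.ext <| funext fun w => by
          simp [smul_dsum, smul_comm d] })
    (fun φ φ' G => LinearMap.ext fun H => Subtype.ext <| funext fun w => by
      simp [plug_add, smul_add, dsum_add])
    (fun d φ G => LinearMap.ext fun H => Subtype.ext <| funext fun w => by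
      simp [plug_smul, smul_dsum, smul_comm d])
    (fun φ G G' => LinearMap.ext fun H => Subtype.ext <| funext fun w => by
      simp [smul_add, dsum_add])
    (fun d φ G => LinearMap.ext fun H => Subtype.ext <| funext fun w => by
      simp [smul_dsum, smul_comm d])

theorem comp_apply (b : ℤ) (φ G : Mult K U) (w : List (HV U)) : (comp b φ G).1 w =
    dsum (fun p u => dsum (fun q r => sg K b p • slot φ p r (G.1 q)) u) w := rfl

theorem brace_apply (b c : ℤ) (φ G H : Mult K U) (w : List (HV U)) : (brace b c φ G H).1 w =
    dsum (fun p u => dsum (fun q r =>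
      (sg K b p * sg K c p * sg K c q) • (comp c (plug p φ (G.1 q)) H).1 r) u) w := rfl

/-- `h` lifts the multilinear function `G` to homogeneous elements. -/
def IsLift (h : List (HV U) → HV U) (G : Mult K U) : Prop := ∀ w, G.1 w = (h w).toTot K

theorem comp_eq_ins1 {h : List (HV U) → HV U} {G : Mult K U} (hG : IsLift h G) (b : ℤ)
    (φ : Mult K U) (w : List (HV U)) : (comp b φ G).1 w = ins1 (sg K b) h φ.1 w := by
  simp only [comp_apply, ins1, hG _, slot_toTot]

theorem brace_eq_ins2 {g h : List (HV U) → HV U} {G H : Mult K U} (hG : IsLift g G)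
    (hH : IsLift h H) (b c : ℤ) (φ : Mult K U) (w : List (HV U)) :
    (brace b c φ G H).1 w = ins2 (sg K b) (sg K c) g h φ.1 w := by
  simp only [brace_apply, ins2, hG _, comp_eq_ins1 hH, coe_plug, slot_toTot]

theorem map_ins1 {A Y Z : Type*} [AddCommGroup Y] [Module K Y] [AddCommGroup Z] [Module K Z]
    (L : Y →ₗ[K] Z) (χ : List A → K) (h : List A → A) (φ : List A → Y) (w : List A) :
    L (ins1 χ h φ w) = ins1 χ h (fun x => L (φ x)) w := by
  simp only [ins1, map_dsum, map_smul]

theorem coe_ins1 {A : Type*} (χ : List A → K) (h : List A → A) (φ : List A → Mult K U)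
    (w : List A) : (ins1 χ h φ w).1 = fun x => ins1 χ h (fun y => (φ y).1 x) w :=
  funext fun x => map_ins1 (evalWord x) χ h φ w

theorem map_ins2 {A Y Z : Type*} [AddCommGroup Y] [Module K Y] [AddCommGroup Z] [Module K Z]
    (L : Y →ₗ[K] Z) (χ ψ : List A → K) (g h : List A → A) (φ : List A → Y) (w : List A) :
    L (ins2 χ ψ g h φ w) = ins2 χ ψ g h (fun x => L (φ x)) w := by
  simp only [ins2, map_dsum, map_smul, map_ins1]

/-- A multilinear function which is homogeneous of odd degree, up to the degrees of its inputs. -/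
def IsOdd (G : Mult K U) : Prop := ∃ h, IsLift h G ∧ IsOddFor (sg K 1) h

theorem brace_comp_sub_comp_brace (φ : Mult K U) {G H₁ H₂ : Mult K U} (hG : IsOdd G)
    (hH₁ : IsOdd H₁) (hH₂ : IsOdd H₂) :
    brace 1 1 (comp 1 φ G) H₁ H₂ - comp 1 (brace 1 1 φ H₁ H₂) G =
      comp 1 φ (brace 1 1 G H₁ H₂) + brace 0 1 φ (comp 1 G H₁) H₂ +
        brace 0 1 φ (comp 1 H₁ G) H₂ - brace 1 0 φ H₁ (comp 1 G H₂) -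
        brace 1 0 φ H₁ (comp 1 H₂ G) := by
  obtain ⟨g, lg, og⟩ := hG
  obtain ⟨h₁, l₁, o₁⟩ := hH₁
  obtain ⟨h₂, l₂, o₂⟩ := hH₂
  refine Subtype.ext <| funext fun w => ?_
  have key := ins2_ins1_sub_ins1_ins2 (isSign_sg (K := K) 1) og o₁ o₂ φ.1 w
  have e₁ : (brace 1 1 (comp 1 φ G) H₁ H₂).1 w =
      ins2 (sg K 1) (sg K 1) h₁ h₂ (ins1 (sg K 1) g φ.1) w := by
    rw [brace_eq_ins2 l₁ l₂]
    congr 1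
    exact funext fun x => comp_eq_ins1 lg _ _ _
  have e₂ : (comp 1 (brace 1 1 φ H₁ H₂) G).1 w =
      ins1 (sg K 1) g (ins2 (sg K 1) (sg K 1) h₁ h₂ φ.1) w := by
    rw [comp_eq_ins1 lg]
    congr 1
    exact funext fun x => brace_eq_ins2 l₁ l₂ _ _ _ _
  change (brace 1 1 (comp 1 φ G) H₁ H₂).1 w - (comp 1 (brace 1 1 φ H₁ H₂) G).1 w =
    (comp 1 φ (brace 1 1 G H₁ H₂)).1 w + (brace 0 1 φ (comp 1 G H₁) H₂).1 w +
      (brace 0 1 φ (comp 1 H₁ G) H₂).1 w - (brace 1 0 φ H₁ (comp 1 G H₂)).1 w -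
      (brace 1 0 φ H₁ (comp 1 H₂ G)).1 w
  rw [e₁, e₂, key]
  simp only [comp_apply 1 φ, brace_apply 0, brace_apply 1 0, brace_eq_ins2 l₁ l₂,
    comp_eq_ins1 l₁, comp_eq_ins1 l₂, comp_eq_ins1 lg, comp_apply 0, map_ins2, map_ins1, coe_ins1,
    lg _, l₁ _, l₂ _, slot_toTot, coe_plug, sg_zero, one_mul, mul_one, one_smul]

end Multilinear

section Convolution

variable {ι : Type*} [Fintype ι] [DecidableEq ι]

theorem mem_below {α β : MI ι} : β ∈ below ι α ↔ β ≤ α := by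
  simp [below, Pi.le_def]

variable {Y : Type*} [AddCommGroup Y]

/-- The sum of `Φ β γ` over all decompositions `α = β + γ`. -/
def csum (Φ : MI ι → MI ι → Y) (α : MI ι) : Y := ∑ β ∈ below ι α, Φ β (α - β)

theorem csum_congr {Φ Ψ : MI ι → MI ι → Y} {α : MI ι} (h : ∀ β γ, β + γ = α → Φ β γ = Ψ β γ) :
    csum Φ α = csum Ψ α :=
  Finset.sum_congr rfl fun _ hβ => h _ _ (add_tsub_cancel_of_le (mem_below.1 hβ))

theorem csum_add (Φ Ψ : MI ι → MI ι → Y) (α : MI ι) :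
    csum (fun β γ => Φ β γ + Ψ β γ) α = csum Φ α + csum Ψ α :=
  Finset.sum_add_distrib

theorem csum_sub (Φ Ψ : MI ι → MI ι → Y) (α : MI ι) :
    csum (fun β γ => Φ β γ - Ψ β γ) α = csum Φ α - csum Ψ α :=
  Finset.sum_sub_distrib _ _

theorem smul_csum {R : Type*} [Monoid R] [DistribMulAction R Y] (c : R) (Φ : MI ι → MI ι → Y)
    (α : MI ι) :
    c • csum Φ α = csum (fun β γ => c • Φ β γ) α :=
  Finset.smul_sum

theorem map_csum {Z G : Type*} [AddCommGroup Z] [FunLike G Y Z] [AddMonoidHomClass G Y Z] (L : G)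
    (Φ : MI ι → MI ι → Y) (α : MI ι) : L (csum Φ α) = csum (fun β γ => L (Φ β γ)) α :=
  map_sum L _ _

theorem csum_comm (Φ : MI ι → MI ι → Y) (α : MI ι) :
    csum Φ α = csum (fun β γ => Φ γ β) α := by
  refine Finset.sum_nbij' (fun β => α - β) (fun β => α - β) ?_ ?_ ?_ ?_ ?_ <;>
    simp +contextual [mem_below, tsub_tsub_cancel_of_le]

theorem csum_csum_comm (F : MI ι → MI ι → MI ι → MI ι → Y) (α β : MI ι) :
    csum (fun a b => csum (fun c d => F a b c d) β) α =
      csum (fun c d => csum (fun a b => F a b c d) α) β :=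
  Finset.sum_comm

theorem csum_assoc (Φ : MI ι → MI ι → MI ι → Y) (α : MI ι) :
    csum (fun x δ => csum (fun β γ => Φ β γ δ) x) α =
      csum (fun β u => csum (fun γ δ => Φ β γ δ) u) α := by
  simp only [csum, Finset.sum_sigma']
  refine Finset.sum_bij' (fun x _ => ⟨x.2, x.1 - x.2⟩) (fun x _ => ⟨x.1 + x.2, x.1⟩) ?_ ?_ ?_ ?_ ?_
  · rintro ⟨x, y⟩ h
    simp only [Finset.mem_sigma, mem_below] at h ⊢
    exact ⟨h.2.trans h.1, tsub_le_tsub_right h.1 _⟩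
  · rintro ⟨x, y⟩ h
    simp only [Finset.mem_sigma, mem_below] at h ⊢
    exact ⟨(add_le_add_right h.2 x).trans_eq (add_tsub_cancel_of_le h.1), le_self_add⟩
  · rintro ⟨x, y⟩ h
    simp only [Finset.mem_sigma, mem_below] at h
    simp [add_tsub_cancel_of_le h.2]
  · rintro ⟨x, y⟩ h
    simp
  · rintro ⟨x, y⟩ h
    simp only [Finset.mem_sigma, mem_below] at h
    simp only [tsub_tsub, add_tsub_cancel_of_le h.2]

theorem csum_left_comm (Φ : MI ι → MI ι → MI ι → Y) (α : MI ι) :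
    csum (fun β u => csum (fun γ δ => Φ β γ δ) u) α =
      csum (fun γ u => csum (fun β δ => Φ β γ δ) u) α := by
  rw [← csum_assoc, ← csum_assoc fun γ β δ => Φ β γ δ]
  exact csum_congr fun x δ _ => csum_comm _ _

theorem csum_single (Φ : MI ι → MI ι → Y) (i : ι) (α : MI ι) :
    csum (fun β γ => β i • Φ β γ) (α + Pi.single i 1) =
      csum (fun β γ => (β i + 1) • Φ (β + Pi.single i 1) γ) α := by
  symm
  refine Finset.sum_bij_ne_zero (fun β _ _ => β + Pi.single i 1) ?_ ?_ ?_ ?_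
  · intro β h _
    exact mem_below.2 (add_le_add_left (mem_below.1 h) _)
  · intro β _ _ γ _ _ h
    exact add_right_cancel h
  · intro β h h0
    have hi : Pi.single i 1 ≤ β := by
      intro j
      rcases eq_or_ne j i with rfl | hj
      · simpa [Nat.one_le_iff_ne_zero] using left_ne_zero_of_smul h0
      · simp [hj]
    obtain ⟨γ, rfl⟩ := exists_add_of_le hi
    rw [add_comm _ γ] at h h0 ⊢
    refine ⟨γ, mem_below.2 (le_of_add_le_add_right (mem_below.1 h)), ?_, rfl⟩
    simpa [add_tsub_add_eq_tsub_right] using h0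
  · intro β h _
    simp [add_tsub_add_eq_tsub_right]

theorem csum_add_single (Φ : MI ι → MI ι → Y) (i : ι) (α : MI ι) :
    (α i + 1) • csum Φ (α + Pi.single i 1) =
      csum (fun β γ => (β i + 1) • Φ (β + Pi.single i 1) γ) α +
        csum (fun β γ => (γ i + 1) • Φ β (γ + Pi.single i 1)) α := by
  have h : csum (fun β γ => (γ i + 1) • Φ β (γ + Pi.single i 1)) α =
      csum (fun β γ => γ i • Φ β γ) (α + Pi.single i 1) := by
    rw [csum_comm]
    exact (csum_single (fun γ β => Φ β γ) i α).symm.trans (csum_comm _ _)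
  rw [h, ← csum_single, ← csum_add, smul_csum]
  refine csum_congr fun β γ h => ?_
  have := congrFun h i
  simp only [Pi.add_apply, Pi.single_eq_same] at this
  rw [← this, add_smul]

end Convolution

section PartialDerivatives

variable {ι X : Type*} [DecidableEq ι] [AddCommGroup X]

/-- The formal partial derivative of a power series. -/
def pd (i : ι) (F : MI ι → X) : MI ι → X := fun α => (α i + 1) • F (α + Pi.single i 1)

theorem pd_zero (i : ι) : pd i (0 : MI ι → X) = 0 := funext fun α => by simp [pd]

theorem pd_add (i : ι) (F G : MI ι → X) : pd i (F + G) = pd i F + pd i G :=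
  funext fun α => by simp [pd]

end PartialDerivatives

section ConvolutionProducts

variable {ι : Type*} [Fintype ι] [DecidableEq ι] {K : Type*} [Field K] {X Y Z W : Type*}
  [AddCommGroup X] [Module K X] [AddCommGroup Y] [Module K Y] [AddCommGroup Z] [Module K Z]
  [AddCommGroup W] [Module K W]

/-- The coefficientwise (Cauchy product) extension of a bilinear map to power series. -/
def conv (L : X →ₗ[K] Y →ₗ[K] Z) : (MI ι → X) →ₗ[K] (MI ι → Y) →ₗ[K] MI ι → Z :=
  LinearMap.mk₂ K (fun F G => csum fun β γ => L (F β) (G γ))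
    (fun F F' G => funext fun α => by simp [csum_add])
    (fun c F G => funext fun α => by simp [smul_csum])
    (fun F G G' => funext fun α => by simp [csum_add])
    (fun c F G => funext fun α => by simp [smul_csum])

theorem map_csum₂ (L : X →ₗ[K] Y →ₗ[K] Z) (Φ : MI ι → MI ι → X) (α : MI ι) (y : Y) :
    L (csum Φ α) y = csum (fun β γ => L (Φ β γ) y) α :=
  map_csum (L.flip y) Φ α

theorem map_csum₃ (T : X →ₗ[K] Y →ₗ[K] Z →ₗ[K] W) (Φ : MI ι → MI ι → X) (α : MI ι) (y : Y) (z : Z) :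
    T (csum Φ α) y z = csum (fun β γ => T (Φ β γ) y z) α :=
  map_csum (LinearMap.applyₗ z ∘ₗ T.flip y) Φ α

theorem conv_apply (L : X →ₗ[K] Y →ₗ[K] Z) (F : MI ι → X) (G : MI ι → Y) (α : MI ι) :
    conv L F G α = csum (fun β γ => L (F β) (G γ)) α := rfl

/-- The coefficientwise (Cauchy product) extension of a trilinear map to power series. -/
def conv₃ (T : X →ₗ[K] Y →ₗ[K] Z →ₗ[K] W) :
    (MI ι → X) →ₗ[K] (MI ι → Y) →ₗ[K] (MI ι → Z) →ₗ[K] MI ι → W :=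
  LinearMap.mk₂ K
    (fun F G =>
      { toFun H := csum fun β u => csum (fun γ δ => T (F β) (G γ) (H δ)) u
        map_add' H H' := funext fun α => by simp [csum_add]
        map_smul' c H := funext fun α => by simp [smul_csum] })
    (fun F F' G => LinearMap.ext fun H => funext fun α => by simp [csum_add])
    (fun c F G => LinearMap.ext fun H => funext fun α => by simp [smul_csum])
    (fun F G G' => LinearMap.ext fun H => funext fun α => by simp [csum_add])
    (fun c F G => LinearMap.ext fun H => funext fun α => by simp [smul_csum])

theorem conv₃_apply (T : X →ₗ[K] Y →ₗ[K] Z →ₗ[K] W) (F : MI ι → X) (G : MI ι → Y) (H : MI ι → Z)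
    (α : MI ι) :
    conv₃ T F G H α = csum (fun β u => csum (fun γ δ => T (F β) (G γ) (H δ)) u) α := rfl

theorem pd_conv (L : X →ₗ[K] Y →ₗ[K] Z) (i : ι) (F : MI ι → X) (G : MI ι → Y) :
    pd i (conv L F G) = conv L (pd i F) G + conv L F (pd i G) := by
  funext α
  simp only [pd, conv_apply, csum_add_single, Pi.add_apply, map_nsmul, LinearMap.smul_apply]

end ConvolutionProducts

section ConvolvedIdentity

variable {ι : Type*} [Fintype ι] [DecidableEq ι] {K : Type*} [Field K] {U : ℤ → Type*}
  [∀ l, AddCommGroup (U l)] [∀ l, Module K (U l)]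

/-- The composition product of power series of multilinear functions, with the signs for a right
factor of odd degree. -/
abbrev pscomp : (MI ι → Mult K U) →ₗ[K] (MI ι → Mult K U) →ₗ[K] MI ι → Mult K U :=
  conv (comp 1)

/-- The binary brace of power series of multilinear functions, with the signs for arguments of
degrees `b` and `c`. -/
abbrev psbrace (b c : ℤ) :
    (MI ι → Mult K U) →ₗ[K] (MI ι → Mult K U) →ₗ[K] (MI ι → Mult K U) →ₗ[K] MI ι → Mult K U :=
  conv₃ (brace b c)

theorem psbrace_pscomp_sub (F : MI ι → Mult K U) {G H₁ H₂ : MI ι → Mult K U}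
    (hG : ∀ α, IsOdd (G α)) (hH₁ : ∀ α, IsOdd (H₁ α)) (hH₂ : ∀ α, IsOdd (H₂ α)) :
    psbrace 1 1 (pscomp F G) H₁ H₂ - pscomp (psbrace 1 1 F H₁ H₂) G =
      pscomp F (psbrace 1 1 G H₁ H₂) + psbrace 0 1 F (pscomp G H₁ + pscomp H₁ G) H₂ -
        psbrace 1 0 F H₁ (pscomp G H₂ + pscomp H₂ G) := by
  funext α
  have e₁ : psbrace 1 1 (pscomp F G) H₁ H₂ α = csum (fun a u => csum (fun b v => csum (fun c d =>
      brace 1 1 (comp 1 (F a) (G b)) (H₁ c) (H₂ d)) v) u) α := by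
    simp only [conv₃_apply, conv_apply, map_csum₃]
    rw [← csum_assoc fun a b u => csum (fun c d =>
      brace 1 1 (comp 1 (F a) (G b)) (H₁ c) (H₂ d)) u]
    exact csum_congr fun x u _ => csum_csum_comm _ _ _
  have e₂ : pscomp (psbrace 1 1 F H₁ H₂) G α = csum (fun a u => csum (fun b v => csum (fun c d =>
      comp 1 (brace 1 1 (F a) (H₁ c) (H₂ d)) (G b)) v) u) α := by
    simp only [conv₃_apply, conv_apply, map_csum₂]
    rw [csum_comm]
    rw [csum_left_comm fun b a u => csum (fun c d =>
      comp 1 (brace 1 1 (F a) (H₁ c) (H₂ d)) (G b)) u]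
  have e₃ : pscomp F (psbrace 1 1 G H₁ H₂) α = csum (fun a u => csum (fun b v => csum (fun c d =>
      comp 1 (F a) (brace 1 1 (G b) (H₁ c) (H₂ d))) v) u) α := by
    simp only [conv₃_apply, conv_apply, map_csum]
  have e₄ : psbrace 0 1 F (pscomp G H₁) H₂ α = csum (fun a u => csum (fun b v => csum (fun c d =>
      brace 0 1 (F a) (comp 1 (G b) (H₁ c)) (H₂ d)) v) u) α := by
    simp only [conv₃_apply, conv_apply, map_csum₂, csum_assoc]
  have e₅ : psbrace 0 1 F (pscomp H₁ G) H₂ α = csum (fun a u => csum (fun b v => csum (fun c d =>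
      brace 0 1 (F a) (comp 1 (H₁ c) (G b)) (H₂ d)) v) u) α := by
    simp only [conv₃_apply, conv_apply, map_csum₂, csum_assoc]
    exact csum_congr fun a u _ => csum_left_comm _ _
  have e₆ : psbrace 1 0 F H₁ (pscomp G H₂) α = csum (fun a u => csum (fun b v => csum (fun c d =>
      brace 1 0 (F a) (H₁ c) (comp 1 (G b) (H₂ d))) v) u) α := by
    simp only [conv₃_apply, conv_apply, map_csum]
    exact csum_congr fun a u _ => csum_left_comm _ _
  have e₇ : psbrace 1 0 F H₁ (pscomp H₂ G) α = csum (fun a u => csum (fun b v => csum (fun c d =>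
      brace 1 0 (F a) (H₁ c) (comp 1 (H₂ d) (G b))) v) u) α := by
    simp only [conv₃_apply, conv_apply, map_csum]
    refine csum_congr fun a u _ => ?_
    rw [csum_left_comm fun b c d => brace 1 0 (F a) (H₁ c) (comp 1 (H₂ d) (G b))]
    exact csum_congr fun c v _ => csum_comm _ _
  simp only [map_add, LinearMap.add_apply, Pi.add_apply, Pi.sub_apply, e₁, e₂, e₃, e₄, e₅, e₆, e₇,
    ← csum_add, ← csum_sub]
  refine csum_congr fun a u _ => csum_congr fun b v _ => csum_congr fun c d _ => ?_
  rw [brace_comp_sub_comp_brace (F a) (hG b) (hH₁ c) (hH₂ d)]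
  abel

end ConvolvedIdentity

section Homogeneous

variable {K : Type*} [Field K] {U : ℤ → Type*} [∀ l, AddCommGroup (U l)] [∀ l, Module K (U l)]

variable (K U) in
/-- The homogeneous elements of degree `d` in the total space. -/
def homPart (d : ℤ) : Submodule K (Tot U) := LinearMap.range (DirectSum.lof K ℤ U d)

variable (K U) in
/-- The multilinear functions which are homogeneous of degree `d`. -/
def Hom (d : ℤ) : Submodule K (Mult K U) where
  carrier := {G | ∀ w, G.1 w ∈ homPart K U (d + degSum U w)}
  zero_mem' _ := zero_mem _
  add_mem' hf hg w := add_mem (hf w) (hg w)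
  smul_mem' c _ hf w := Submodule.smul_mem _ c (hf w)

theorem dsum_mem_of_forall {A Y : Type*} [AddCommGroup Y] [Module K Y] (S : Submodule K Y)
    {φ : List A → List A → Y} {w : List A} (h : ∀ p q, p ++ q = w → φ p q ∈ S) : dsum φ w ∈ S :=
  sum_mem fun _ _ => h _ _ (List.take_append_drop _ _)

theorem comp_mem_Hom (c : ℤ) {a b : ℤ} {φ G : Mult K U} (hφ : φ ∈ Hom K U a) (hG : G ∈ Hom K U b) :
    comp c φ G ∈ Hom K U (a + b) := by
  intro w
  rw [comp_apply]
  refine dsum_mem_of_forall _ fun p u hu => dsum_mem_of_forall _ fun q r hr =>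
    Submodule.smul_mem _ _ ?_
  obtain ⟨x, hx⟩ := hG q
  rw [← hx, slot_lof]
  convert hφ (p ++ ⟨_, x⟩ :: r) using 2
  rw [← hu, ← hr]
  simp only [degSum_append, degSum_cons]
  ring

theorem brace_mem_Hom (c₁ c₂ : ℤ) {a b₁ b₂ : ℤ} {φ G H : Mult K U} (hφ : φ ∈ Hom K U a)
    (hG : G ∈ Hom K U b₁) (hH : H ∈ Hom K U b₂) :
    brace c₁ c₂ φ G H ∈ Hom K U (a + b₁ + b₂) := by
  intro w
  rw [brace_apply]
  refine dsum_mem_of_forall _ fun p u hu => dsum_mem_of_forall _ fun q r hr =>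
    Submodule.smul_mem _ _ ?_
  obtain ⟨x, hx⟩ := hG q
  have hp : plug p φ (G.1 q) ∈ Hom K U (a + degSum U p + (b₁ + degSum U q)) := by
    intro s
    simp only [coe_plug, ← hx, slot_lof]
    convert hφ (p ++ ⟨_, x⟩ :: s) using 2
    simp only [degSum_append, degSum_cons]
    ring
  convert comp_mem_Hom c₂ hp hH r using 2
  rw [← hu, ← hr]
  simp only [degSum_append]
  ring

theorem isOdd_of_mem_Hom {d : ℤ} (hd : Odd d) {G : Mult K U} (hG : G ∈ Hom K U d) : IsOdd G := by
  choose x hx using hG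
  refine ⟨fun w => ⟨d + degSum U w, x w⟩, fun w => (hx w).symm, fun q r => ?_⟩
  simp only [sg, one_mul, degSum_cons]
  rw [zpow_add₀ (by simp), zpow_add₀ (by simp), hd.neg_one_zpow]
  ring

variable {ι : Type*} [Fintype ι]

variable (K U) in
/-- The power series of multilinear functions which are homogeneous of degree `d`, where the
variables have degrees `td`. -/
def PSHom (td : ι → ℤ) (d : ℤ) : Submodule K (MI ι → Mult K U) :=
  Submodule.pi Set.univ fun α => Hom K U (d - degM ι td α)

theorem mem_PSHom {td : ι → ℤ} {d : ℤ} {F : MI ι → Mult K U} :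
    F ∈ PSHom K U td d ↔ ∀ α, F α ∈ Hom K U (d - degM ι td α) := by
  simp [PSHom]

theorem degM_add (td : ι → ℤ) (α β : MI ι) : degM ι td (α + β) = degM ι td α + degM ι td β := by
  simp [degM, add_mul, Finset.sum_add_distrib]

theorem even_degM {td : ι → ℤ} (h : ∀ i, Even (td i)) (α : MI ι) : Even (degM ι td α) :=
  Finset.even_sum _ fun i _ => (h i).mul_left _

theorem isOdd_of_mem_PSHom {td : ι → ℤ} (h : ∀ i, Even (td i)) {d : ℤ} (hd : Odd d)
    {F : MI ι → Mult K U} (hF : F ∈ PSHom K U td d) (α : MI ι) : IsOdd (F α) :=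
  isOdd_of_mem_Hom (hd.sub_even (even_degM h α)) (mem_PSHom.1 hF α)

variable [DecidableEq ι]

theorem degM_single (td : ι → ℤ) (i : ι) : degM ι td (Pi.single i 1) = td i := by
  simp [degM, Pi.single_apply]

theorem pd_mem_PSHom {td : ι → ℤ} {d : ℤ} {F : MI ι → Mult K U} (i : ι)
    (hF : F ∈ PSHom K U td d) : pd i F ∈ PSHom K U td (d - td i) := by
  refine mem_PSHom.2 fun α => nsmul_mem ?_ _
  have := mem_PSHom.1 hF (α + Pi.single i 1)
  rwa [degM_add, degM_single, ← sub_sub, sub_right_comm] at this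

theorem csum_mem_of_forall {Y : Type*} [AddCommGroup Y] [Module K Y] (S : Submodule K Y)
    {Φ : MI ι → MI ι → Y} {α : MI ι} (h : ∀ β γ, β + γ = α → Φ β γ ∈ S) : csum Φ α ∈ S :=
  sum_mem fun _ hβ => h _ _ (add_tsub_cancel_of_le (mem_below.1 hβ))

theorem psbrace_mem_PSHom {td : ι → ℤ} {a b c : ℤ} {F G H : MI ι → Mult K U} (c₁ c₂ : ℤ)
    (hF : F ∈ PSHom K U td a) (hG : G ∈ PSHom K U td b) (hH : H ∈ PSHom K U td c) :
    psbrace c₁ c₂ F G H ∈ PSHom K U td (a + b + c) := by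
  refine mem_PSHom.2 fun α => csum_mem_of_forall _ fun β u h₁ => csum_mem_of_forall _
    fun γ δ h₂ => ?_
  convert brace_mem_Hom c₁ c₂ (mem_PSHom.1 hF β) (mem_PSHom.1 hG γ) (mem_PSHom.1 hH δ) using 2
  rw [← h₁, ← h₂, degM_add, degM_add]
  ring

end Homogeneous

section CupDegrees

variable {ι : Type*}

/-- The degree of an iterated cup product of partial derivatives. -/
def cupDeg (td : ι → ℤ) : CupExpr ι → ℤ
  | .leaf i => 1 - td i
  | .node P Q => cupDeg td P + cupDeg td Q + 1

theorem odd_cupDeg {td : ι → ℤ} (hEven : ∀ i, Even (td i)) (P : CupExpr ι) : Odd (cupDeg td P) := by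
  induction P with
  | leaf i => exact odd_one.sub_even (hEven i)
  | node P Q hP hQ => exact (hP.add_odd hQ).add_one

end CupDegrees

section CupProducts

variable {ι : Type*} [Fintype ι] [DecidableEq ι] {K : Type*} [Field K] {U : ℤ → Type*}
  [∀ l, AddCommGroup (U l)] [∀ l, Module K (U l)]

/-- The Gerstenhaber bracket of power series of odd degrees. -/
def oddBracket (F G : MI ι → Mult K U) : MI ι → Mult K U := pscomp F G + pscomp G F

theorem oddBracket_comm (F G : MI ι → Mult K U) : oddBracket F G = oddBracket G F :=
  add_comm _ _

theorem oddBracket_brace {M A B C : MI ι → Mult K U} (hM : ∀ α, IsOdd (M α)) (hA : ∀ α, IsOdd (A α))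
    (hB : ∀ α, IsOdd (B α)) (hC : ∀ α, IsOdd (C α)) (h : oddBracket M A = 0) :
    oddBracket A (psbrace 1 1 M B C) = -oddBracket M (psbrace 1 1 A B C) -
      psbrace 0 1 M (oddBracket A B) C + psbrace 1 0 M B (oddBracket A C) -
      psbrace 0 1 A (oddBracket M B) C + psbrace 1 0 A B (oddBracket M C) := by
  have h₁ := psbrace_pscomp_sub A hM hB hC
  have h₂ := psbrace_pscomp_sub M hA hB hC
  have h₃ : psbrace 1 1 (pscomp M A) B C + psbrace 1 1 (pscomp A M) B C = 0 := by
    rw [← LinearMap.add_apply, ← LinearMap.add_apply, ← map_add]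
    rw [oddBracket] at h
    simp [h]
  simp only [oddBracket] at *
  linear_combination (norm := module) h₃ - h₁ - h₂

theorem oddBracket_self_brace {M B C : MI ι → Mult K U} (hM : ∀ α, IsOdd (M α))
    (hB : ∀ α, IsOdd (B α)) (hC : ∀ α, IsOdd (C α)) (h : pscomp M M = 0) :
    oddBracket M (psbrace 1 1 M B C) =
      psbrace 1 0 M B (oddBracket M C) - psbrace 0 1 M (oddBracket M B) C := by
  have h₁ := psbrace_pscomp_sub M hM hB hC
  rw [h, map_zero, LinearMap.zero_apply, LinearMap.zero_apply] at h₁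
  simp only [oddBracket] at *
  linear_combination (norm := module) -h₁

/-- Evaluation of iterated cup products of partial derivatives. -/
def cupSeries (M : MI ι → Mult K U) : CupExpr ι → MI ι → Mult K U
  | .leaf i => pd i M
  | .node P Q => psbrace 1 1 M (cupSeries M P) (cupSeries M Q)

variable {td : ι → ℤ} {M : MI ι → Mult K U}

theorem cupSeries_mem (hM : M ∈ PSHom K U td 1) (P : CupExpr ι) :
    cupSeries M P ∈ PSHom K U td (cupDeg td P) := by
  induction P with
  | leaf i => exact pd_mem_PSHom i hM
  | node P Q hP hQ =>
    rw [cupSeries]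
    convert psbrace_mem_PSHom 1 1 hM hP hQ using 2
    simp only [cupDeg]
    ring

theorem isOdd_cupSeries (hEven : ∀ i, Even (td i)) (hM : M ∈ PSHom K U td 1) (P : CupExpr ι)
    (α : MI ι) : IsOdd (cupSeries M P α) :=
  isOdd_of_mem_PSHom hEven (odd_cupDeg hEven P) (cupSeries_mem hM P) α

theorem oddBracket_cupSeries (hEven : ∀ i, Even (td i)) (hM : M ∈ PSHom K U td 1)
    (hMM : pscomp M M = 0) (P : CupExpr ι) : oddBracket M (cupSeries M P) = 0 := by
  induction P with
  | leaf i =>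
    rw [oddBracket_comm, oddBracket, cupSeries, ← pd_conv, hMM, pd_zero]
  | node P Q hP hQ =>
    rw [cupSeries, oddBracket_self_brace (isOdd_of_mem_PSHom hEven odd_one hM)
      (isOdd_cupSeries hEven hM P) (isOdd_cupSeries hEven hM Q) hMM, hP, hQ]
    simp

theorem oddBracket_add (F G H : MI ι → Mult K U) :
    oddBracket F (G + H) = oddBracket F G + oddBracket F H := by
  simp only [oddBracket, map_add, LinearMap.add_apply]
  abel

theorem oddBracket_neg (F G : MI ι → Mult K U) : oddBracket F (-G) = -oddBracket F G := by
  simp only [oddBracket, map_neg, LinearMap.neg_apply]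
  abel

theorem exists_oddBracket_leaf_leaf (hM : M ∈ PSHom K U td 1) (hMM : pscomp M M = 0) (i j : ι) :
    ∃ R ∈ PSHom K U td (cupDeg td (.leaf i) + cupDeg td (.leaf j) - 1),
      oddBracket (cupSeries M (.leaf i)) (cupSeries M (.leaf j)) = oddBracket M R := by
  refine ⟨-pd j (pd i M), neg_mem ?_, ?_⟩
  · convert pd_mem_PSHom j (pd_mem_PSHom i hM) using 2
    simp only [cupDeg]
    ring
  · have h : pd j (pd i (pscomp M M)) = 0 := by rw [hMM, pd_zero, pd_zero]
    simp only [pd_conv, pd_add] at h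
    rw [oddBracket_neg]
    simp only [oddBracket, cupSeries]
    linear_combination (norm := module) h

theorem exists_oddBracket_node (hEven : ∀ i, Even (td i)) (hM : M ∈ PSHom K U td 1)
    (hMM : pscomp M M = 0) {A B C : CupExpr ι}
    (hB : ∃ R ∈ PSHom K U td (cupDeg td A + cupDeg td B - 1),
      oddBracket (cupSeries M A) (cupSeries M B) = oddBracket M R)
    (hC : ∃ R ∈ PSHom K U td (cupDeg td A + cupDeg td C - 1),
      oddBracket (cupSeries M A) (cupSeries M C) = oddBracket M R) :
    ∃ R ∈ PSHom K U td (cupDeg td A + cupDeg td (.node B C) - 1),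
      oddBracket (cupSeries M A) (cupSeries M (.node B C)) = oddBracket M R := by
  obtain ⟨R₁, hR₁, e₁⟩ := hB
  obtain ⟨R₂, hR₂, e₂⟩ := hC
  have o := isOdd_cupSeries hEven hM
  have z := oddBracket_cupSeries hEven hM hMM
  have oM := isOdd_of_mem_PSHom hEven odd_one hM
  have d := odd_cupDeg hEven
  have o₁ := isOdd_of_mem_PSHom hEven (((d A).add_odd (d B)).sub_odd odd_one) hR₁
  have o₂ := isOdd_of_mem_PSHom hEven (((d A).add_odd (d C)).sub_odd odd_one) hR₂
  refine ⟨-psbrace 1 1 (cupSeries M A) (cupSeries M B) (cupSeries M C) +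
    (psbrace 1 1 M R₁ (cupSeries M C) + psbrace 1 1 M (cupSeries M B) R₂),
    add_mem (neg_mem ?_) (add_mem ?_ ?_), ?_⟩
  · convert psbrace_mem_PSHom 1 1 (cupSeries_mem hM A) (cupSeries_mem hM B)
      (cupSeries_mem hM C) using 2
    simp only [cupDeg]
    ring
  · convert psbrace_mem_PSHom 1 1 hM hR₁ (cupSeries_mem hM C) using 2
    simp only [cupDeg]
    ring
  · convert psbrace_mem_PSHom 1 1 hM (cupSeries_mem hM B) hR₂ using 2
    simp only [cupDeg]
    ring
  · rw [oddBracket_add, oddBracket_add, oddBracket_neg,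
      oddBracket_self_brace oM o₁ (o C) hMM, oddBracket_self_brace oM (o B) o₂ hMM, cupSeries,
      oddBracket_brace oM (o A) (o B) (o C) (z A), z, z, e₁, e₂]
    simp only [map_zero, LinearMap.zero_apply]
    abel

/-- The bracket of two iterated cup products is a coboundary. -/
theorem exists_oddBracket_cupSeries (hEven : ∀ i, Even (td i)) (hM : M ∈ PSHom K U td 1)
    (hMM : pscomp M M = 0) (P Q : CupExpr ι) :
    ∃ R ∈ PSHom K U td (cupDeg td P + cupDeg td Q - 1),
      oddBracket (cupSeries M P) (cupSeries M Q) = oddBracket M R := by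
  have leaf : ∀ i Q, ∃ R ∈ PSHom K U td (cupDeg td (.leaf i) + cupDeg td Q - 1),
      oddBracket (cupSeries M (.leaf i)) (cupSeries M Q) = oddBracket M R := fun i Q => by
    induction Q with
    | leaf j => exact exists_oddBracket_leaf_leaf hM hMM i j
    | node B C hB hC => exact exists_oddBracket_node hEven hM hMM hB hC
  induction Q with
  | leaf i =>
    rw [oddBracket_comm, add_comm (cupDeg td P)]
    exact leaf i P
  | node B C hB hC => exact exists_oddBracket_node hEven hM hMM hB hC

end CupProducts

section Representation

variable {K : Type*} [Field K] {U : ℤ → Type*}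

theorem sg_eq {b : ℤ} (hb : Odd b) (w : List (HV U)) :
    (-1 : K) ^ (b * degSum U w) = sg K 1 w := by
  rw [sg, one_mul, zpow_mul, hb.neg_one_zpow]

variable [∀ l, AddCommGroup (U l)] [∀ l, Module K (U l)]

theorem lof_vcast {a b : ℤ} (h : a = b) (x : U a) :
    DirectSum.lof K ℤ U b (vcast U x) = DirectSum.lof K ℤ U a x := by
  subst h
  simp [vcast]

variable (K U) in
theorem lof_injective (l : ℤ) : Function.Injective (DirectSum.lof K ℤ U l) :=
  DirectSum.of_injective l

/-- The graded map `f` represents the multilinear function `G`. -/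
def Rep {d : ℤ} (f : E U d) (G : Mult K U) : Prop :=
  ∀ w, G.1 w = DirectSum.lof K ℤ U (d + degSum U w) (f w)

theorem isMultilinear_iff {d : ℤ} {f : E U d} :
    IsMultilinear K U f ↔ (fun w => DirectSum.lof K ℤ U (d + degSum U w) (f w)) ∈ Mult K U := by
  have e : ∀ (xs zs : List (HV U)) (l : ℤ) (x : U l),
      d + degSum U (xs ++ ⟨l, x⟩ :: zs) = d + degSum U xs + l + degSum U zs := fun xs zs l x => by
    rw [degSum_append, degSum_cons]
    ring
  refine ⟨fun h xs zs l => ⟨fun x y => ?_, fun c x => ?_⟩, fun h =>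
    ⟨fun xs zs l x y => lof_injective K U _ ?_, fun xs zs l c x => lof_injective K U _ ?_⟩⟩
  · beta_reduce
    rw [← lof_vcast (e _ _ _ _), h.1, map_add, lof_vcast (e _ _ _ _), lof_vcast (e _ _ _ _)]
  · beta_reduce
    rw [← lof_vcast (e _ _ _ _), h.2, map_smul, lof_vcast (e _ _ _ _)]
  · rw [map_add, lof_vcast (e _ _ _ _), lof_vcast (e _ _ _ _), lof_vcast (e _ _ _ _)]
    exact (h xs zs l).map_add x y
  · rw [map_smul, lof_vcast (e _ _ _ _), lof_vcast (e _ _ _ _)]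
    exact (h xs zs l).map_smul c x

theorem rep_mk {d : ℤ} {f : E U d} (hf : IsMultilinear K U f) :
    Rep f (⟨_, isMultilinear_iff.1 hf⟩ : Mult K U) := fun _ => rfl

variable {a b c : ℤ} {f f' : E U a} {F F' G H : Mult K U} {g : E U b} {h : E U c}

theorem Rep.isMultilinear (hf : Rep f F) : IsMultilinear K U f :=
  isMultilinear_iff.2 (by convert F.2 using 1; exact (funext hf).symm)

theorem Rep.unique (hf : Rep f F) (hf' : Rep f' F) : f = f' :=
  funext fun w => lof_injective K U _ ((hf w).symm.trans (hf' w))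

theorem Rep.mem_Hom (hf : Rep f F) : F ∈ Hom K U a := fun w => ⟨f w, (hf w).symm⟩

theorem exists_rep (hF : F ∈ Hom K U a) : ∃ f : E U a, Rep f F := by
  choose f hf using hF
  exact ⟨f, fun w => (hf w).symm⟩

theorem Rep.eq_zero (hF : Rep (0 : E U a) F) : F = 0 :=
  Subtype.ext (funext fun w => by simp [hF w])

theorem Rep.sub (hf : Rep f F) (hf' : Rep f' F') : Rep (f - f') (F - F') := fun w => by
  simp [hf w, hf' w]

theorem Rep.smul (t : K) (hf : Rep f F) : Rep (t • f) (t • F) := fun w => by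
  simp [hf w]

theorem rep_sum {κ : Type*} {s : Finset κ} {f : κ → E U a} {F : κ → Mult K U}
    (hf : ∀ i ∈ s, Rep (f i) (F i)) : Rep (∑ i ∈ s, f i) (∑ i ∈ s, F i) := fun w => by
  rw [Submodule.coe_sum, Finset.sum_apply, Finset.sum_apply, map_sum]
  exact Finset.sum_congr rfl fun i hi => hf i hi w

theorem rep_recast (e : a = b) (hf : Rep f F) : Rep (recast U f : E U b) F := fun w => by
  rw [hf w, recast, lof_vcast (by rw [e])]

theorem rep_gcomp (hb : Odd b) (hf : Rep f F) (hg : Rep g G) :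
    Rep (gcomp K U f g) (comp 1 F G) := by
  intro w
  have e : gcomp K U f g w = dsum (fun p u => dsum (fun q r => ((-1 : K) ^ (b * degSum U p)) •
      vcast U (f (p ++ ⟨b + degSum U q, g q⟩ :: r))) u) w := sum_map_splits3
        (fun p q r => ((-1 : K) ^ (b * degSum U p)) •
          (vcast U (f (p ++ ⟨b + degSum U q, g q⟩ :: r)) : U (a + b + degSum U w))) w
  rw [e, map_dsum, comp_apply]
  refine dsum_congr fun p u hu => ?_
  rw [map_dsum]
  refine dsum_congr fun q r hr => ?_
  rw [map_smul, sg_eq hb, hg q, slot_lof, hf, lof_vcast]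
  rw [← hu, ← hr]
  simp only [degSum_append, degSum_cons]
  ring

theorem braces_pair_apply (w : List (HV U)) : braces K U f [⟨b, g⟩, ⟨c, h⟩] w =
    dsum (fun p u => dsum (fun q v => dsum (fun x y => dsum (fun z r => ((-1 : K) ^
      (b * degSum U p + c * (degSum U p + degSum U q) + c * degSum U x)) •
      vcast U (f (p ++ ⟨b + degSum U q, g q⟩ :: (x ++ ⟨c + degSum U z, h z⟩ :: r)))) y) v) u)
      w := by
  simp only [← sum_map_splits3]
  simp only [braces, ins, List.map_flatMap, List.map_map]
  rw [List.flatMap_def, List.sum_flatten, List.map_map]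
  refine congrArg List.sum (List.map_congr_left fun p _ => ?_)
  simp only [List.map_cons, List.map_nil, ← List.map_eq_flatMap]
  simp [degl, Function.comp_def]

theorem rep_braces (hb : Odd b) (hc : Odd c) (hf : Rep f F) (hg : Rep g G) (hh : Rep h H) :
    Rep (braces K U f [⟨b, g⟩, ⟨c, h⟩]) (brace 1 1 F G H) := by
  intro w
  rw [braces_pair_apply, map_dsum, brace_apply]
  refine dsum_congr fun p u hu => ?_
  rw [map_dsum]
  refine dsum_congr fun q v hv => ?_
  rw [map_dsum, comp_apply, smul_dsum]
  refine dsum_congr fun x y hy => ?_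
  rw [map_dsum, smul_dsum]
  refine dsum_congr fun z r hr => ?_
  rw [map_smul, hg q, hh z, slot_lof, coe_plug]
  beta_reduce
  rw [slot_lof, hf, lof_vcast, smul_smul]
  · congr 1
    rw [mul_add, zpow_add₀ (by simp), zpow_add₀ (by simp), zpow_add₀ (by simp)]
    simp only [sg_eq hb, sg_eq hc]
    ring
  · rw [← hu, ← hv, ← hy, ← hr]
    simp only [degSum_append, degSum_cons, degl, List.map_cons, List.map_nil, List.sum_cons,
      List.sum_nil]
    ring

end Representation

section PowerSeriesRepresentation

variable {ι : Type*} [Fintype ι] {K : Type*} [Field K] {U : ℤ → Type*}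
  [∀ l, AddCommGroup (U l)] [∀ l, Module K (U l)] {td : ι → ℤ}

/-- The power series `F` of graded maps represents the power series `F'` of multilinear
functions. -/
def PRep {d : ℤ} (F : PS U ι td d) (F' : MI ι → Mult K U) : Prop := ∀ α, Rep (F α) (F' α)

variable {a b : ℤ} {m : PS U ι td 1} {F : PS U ι td a} {G : PS U ι td b}
  {M F' F'' G' : MI ι → Mult K U}

theorem PRep.unique {F₁ : PS U ι td a} (hF : PRep F F') (hF₁ : PRep F₁ F') : F = F₁ :=
  funext fun α => (hF α).unique (hF₁ α)

theorem PRep.mem_PSHom (hF : PRep F F') : F' ∈ PSHom K U td a :=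
  Ainf.mem_PSHom.2 fun α => (hF α).mem_Hom

theorem exists_pRep (hF : F' ∈ PSHom K U td a) : ∃ F : PS U ι td a, PRep F F' := by
  choose F hF using fun α => exists_rep (mem_PSHom.1 hF α)
  exact ⟨F, hF⟩

theorem PRep.sub {F₁ : PS U ι td a} (hF : PRep F F') (hF₁ : PRep F₁ F'') :
    PRep (F - F₁) (F' - F'') := fun α => (hF α).sub (hF₁ α)

theorem PRep.smul (t : K) (hF : PRep F F') : PRep (t • F) (t • F') := fun α => (hF α).smul t

theorem pRep_precast (e : a = b) (hF : PRep F F') : PRep (precast U ι td F : PS U ι td b) F' :=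
  fun α => rep_recast (by rw [e]) (hF α)

variable [DecidableEq ι]

theorem degM_add_degM_sub {α β : MI ι} (hβ : β ∈ below ι α) :
    degM ι td β + degM ι td (α - β) = degM ι td α := by
  rw [← degM_add, add_tsub_cancel_of_le (mem_below.1 hβ)]

theorem pRep_pderiv (i : ι) (hF : PRep F F') : PRep (pderiv K U ι td F i) (pd i F') := fun α => by
  rw [pd, ← Nat.cast_smul_eq_nsmul K]
  refine (rep_recast ?_ (hF _)).smul _
  rw [degM_add, degM_single, ← sub_sub, sub_right_comm]

theorem pRep_pcomp (hEven : ∀ i, Even (td i)) (hb : Odd b) (hF : PRep F F') (hG : PRep G G') :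
    PRep (pcomp K U ι td F G) (pscomp F' G') := fun α =>
  rep_sum fun β hβ => rep_recast (by rw [← degM_add_degM_sub hβ]; ring)
    (rep_gcomp (hb.sub_even (even_degM hEven _)) (hF β) (hG _))

theorem pRep_pbr2 (hEven : ∀ i, Even (td i)) (ha : Odd a) (hb : Odd b) (hm : PRep m M)
    (hF : PRep F F') (hG : PRep G G') :
    PRep (pbr2 K U ι td m F G) (psbrace 1 1 M F' G') := fun α =>
  rep_sum fun β hβ => rep_sum fun γ hγ => rep_recast
    (by simp only [degl, List.map_cons, List.map_nil, List.sum_cons, List.sum_nil]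
        rw [← degM_add_degM_sub hβ, ← degM_add_degM_sub hγ]; ring)
    (rep_braces (ha.sub_even (even_degM hEven _)) (hb.sub_even (even_degM hEven _)) (hm β) (hF γ)
      (hG _))

theorem pRep_pcup (hEven : ∀ i, Even (td i)) (ha : Odd a) (hb : Odd b) (hm : PRep m M)
    (hF : PRep F F') (hG : PRep G G') :
    PRep (pcup K U ι td m F G) (psbrace 1 1 M F' G') := by
  rw [pcup, (ha.sub_odd odd_one).neg_one_zpow, one_smul]
  exact pRep_pbr2 hEven ha hb hm hF hG

theorem pRep_pbr (hEven : ∀ i, Even (td i)) (ha : Odd a) (hb : Odd b) (hF : PRep F F')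
    (hG : PRep G G') : PRep (pbr K U ι td F G) (oddBracket F' G') := by
  rw [oddBracket, ← sub_neg_eq_add (pscomp F' G'), ← neg_one_smul K, ← (ha.mul hb).neg_one_zpow]
  exact (pRep_pcomp hEven hb hF hG).sub
    ((pRep_precast (add_comm b a) (pRep_pcomp hEven ha hG hF)).smul _)

theorem pRep_pM1 (hEven : ∀ i, Even (td i)) (ha : Odd a) (hm : PRep m M) (hF : PRep F F') :
    PRep (pM1 K U ι td m F) (oddBracket M F') := by
  rw [oddBracket, ← sub_neg_eq_add (pscomp M F'), ← neg_one_smul K, ← ha.neg_one_zpow]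
  exact (pRep_precast (add_comm 1 a) (pRep_pcomp hEven ha hm hF)).sub
    ((pRep_precast rfl (pRep_pcomp hEven odd_one hF hm)).smul _)

theorem evalCup_fst (P : CupExpr ι) : (evalCup K U td m P).1 = cupDeg td P := by
  induction P with
  | leaf i => rfl
  | node P Q hP hQ => rw [cupDeg, ← hP, ← hQ]; rfl

theorem pRep_evalCup (hEven : ∀ i, Even (td i)) (hm : PRep m M) (P : CupExpr ι) :
    PRep (evalCup K U td m P).2 (cupSeries M P) := by
  induction P with
  | leaf i => exact pRep_pderiv i hm
  | node P Q hP hQ =>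
    refine pRep_pcup hEven ?_ ?_ hm hP hQ <;>
      exact (evalCup_fst (K := K) (m := m) _).symm ▸ odd_cupDeg hEven _

end PowerSeriesRepresentation

/-- Let `m` be a formal multi-parameter family of `A∞`-structures on
`V`, with parameters of even degrees. For any two iterated cup products `P`, `Q` (with
any bracketing) of the partial derivatives `m₍ᵢ₎`, the Gerstenhaber bracket `[P,Q]` is an
`M₁`-coboundary: the Lie bracket induced on the cup-product subalgebra of the
`M₁`-cohomology generated by the classes `[m₍ᵢ₎]` is trivial. -/
theorem bracket_of_cup_products_trivial (td : ι → ℤ) (hEven : ∀ i, Even (td i))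
    (m : PS V ι td 1) (hmult : ∀ α, IsMultilinear k V (m α))
    (hMC : pcomp k V ι td m m = 0) (P Q : CupExpr ι) :
    ∃ R : PS V ι td ((evalCup k V td m P).1 + (evalCup k V td m Q).1 - 1),
      (∀ α, IsMultilinear k V (R α)) ∧
      pbr k V ι td (evalCup k V td m P).2 (evalCup k V td m Q).2 =
        precast V ι td (pM1 k V ι td m R) := by
  have hm : PRep m fun α => ⟨_, isMultilinear_iff.1 (hmult α)⟩ := fun α => rep_mk (hmult α)
  have hMM := pRep_pcomp hEven odd_one hm hm
  rw [hMC] at hMM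
  obtain ⟨R', hR', e⟩ := exists_oddBracket_cupSeries hEven hm.mem_PSHom
    (funext fun α => (hMM α).eq_zero) P Q
  rw [← evalCup_fst (K := k) (m := m) P, ← evalCup_fst (K := k) (m := m) Q] at hR'
  obtain ⟨R, hR⟩ := exists_pRep hR'
  have odd : ∀ P, Odd (evalCup k V td m P).1 := fun P =>
    (evalCup_fst (K := k) (m := m) P).symm ▸ odd_cupDeg hEven P
  refine ⟨R, fun α => (hR α).isMultilinear, ?_⟩
  refine (pRep_pbr hEven (odd P) (odd Q) (pRep_evalCup hEven hm P)
    (pRep_evalCup hEven hm Q)).unique ?_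
  rw [e]
  exact pRep_precast (sub_add_cancel _ _)
    (pRep_pM1 hEven (((odd P).add_odd (odd Q)).sub_odd odd_one) hm hR)

end Ainf
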